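/- Every ample simplicial complex is homogeneous: if X is ample, then for any two finite subsets U, U' ⊆ V(X), every isomorphism f : X_U → X_{U'} extends to an isomorphism F : X → X with F restricted to X_U equal to f. -/

import Mathlib

/-- An (abstract) simplicial complex with vertices drawn from `ℕ`:
a set of nonempty finite subsets of `ℕ` (the simplexes) closed under
passing to nonempty subsets.  The vertex set `V(X)` is the set of `v`
with `{v}` a simplex. -/
structure SComplex where
  faces : Set (Finset ℕ)
  nonempty_of_mem : ∀ s ∈ faces, s.Nonempty
  down_closed : ∀ s ∈ faces, ∀ t ⊆ s, t.Nonempty → t ∈ faces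

namespace SComplex

/-- The vertex set of a simplicial complex. -/
def vertexSet (X : SComplex) : Set ℕ := {v | {v} ∈ X.faces}

/-- The subcomplex of `X` induced on a set `U` of vertices. -/
def induced (X : SComplex) (U : Set ℕ) : SComplex where
  faces := {s | s ∈ X.faces ∧ (↑s : Set ℕ) ⊆ U}
  nonempty_of_mem := fun s hs => X.nonempty_of_mem s hs.1
  down_closed := fun s hs t hts ht =>
    ⟨X.down_closed s hs.1 t hts ht,
     fun x hx => hs.2 (Finset.mem_coe.mpr (hts (Finset.mem_coe.mp hx)))⟩

/-- The link of a vertex `v`: all simplexes `σ` with `v ∉ σ` and `σ ∪ {v}` a simplex. -/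
def link (X : SComplex) (v : ℕ) : SComplex where
  faces := {s | s ∈ X.faces ∧ v ∉ s ∧ insert v s ∈ X.faces}
  nonempty_of_mem := fun s hs => X.nonempty_of_mem s hs.1
  down_closed := fun s hs t hts ht =>
    ⟨X.down_closed s hs.1 t hts ht,
     fun hv => hs.2.1 (hts hv),
     X.down_closed _ hs.2.2 _ (Finset.insert_subset_insert v hts)
       (Finset.insert_nonempty v t)⟩

/-- `IsIso X Y f` : the map `f` is an isomorphism of simplicial complexes from `X` to `Y`,
i.e. a bijection of the vertex sets which induces a bijection between the sets of simplexes. -/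
def IsIso (X Y : SComplex) (f : ℕ → ℕ) : Prop :=
  Set.BijOn f X.vertexSet Y.vertexSet ∧
    ∀ s : Finset ℕ, (↑s : Set ℕ) ⊆ X.vertexSet → (s ∈ X.faces ↔ s.image f ∈ Y.faces)

/-- Two simplicial complexes are isomorphic. -/
def Isomorphic (X Y : SComplex) : Prop := ∃ f, IsIso X Y f

/-- `X` is universal: every countable simplicial complex is isomorphic to an induced
subcomplex of `X`. -/
def Universal (X : SComplex) : Prop :=
  ∀ Y : SComplex, Y.vertexSet.Countable →
    ∃ U ⊆ X.vertexSet, Isomorphic Y (X.induced U)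

/-- `X` is homogeneous: every isomorphism between finite induced subcomplexes of `X`
extends to an isomorphism of `X` onto itself. -/
def Homogeneous (X : SComplex) : Prop :=
  ∀ U U' : Set ℕ, U.Finite → U'.Finite → U ⊆ X.vertexSet → U' ⊆ X.vertexSet →
    ∀ f : ℕ → ℕ, IsIso (X.induced U) (X.induced U') f →
      ∃ F : ℕ → ℕ, IsIso X X F ∧ Set.EqOn F f U

/-- A Rado complex: a countable simplicial complex which is universal and homogeneous. -/
def IsRado (X : SComplex) : Prop :=
  X.vertexSet.Countable ∧ Universal X ∧ Homogeneous X

/-- The ampleness condition: for every finite `U ⊆ V(X)` and every subcomplex `A` of the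
induced complex `X_U` there is a vertex `v ∈ V(X) - U` with `Lk_X(v) ∩ X_U = A`. -/
def AmpleProp (X : SComplex) : Prop :=
  ∀ U : Set ℕ, U.Finite → U ⊆ X.vertexSet →
    ∀ A : SComplex, A.faces ⊆ (X.induced U).faces →
      ∃ v ∈ X.vertexSet \ U, (X.link v).faces ∩ (X.induced U).faces = A.faces

/-- An ample complex: a countable simplicial complex satisfying the ampleness condition. -/
def IsAmple (X : SComplex) : Prop := X.vertexSet.Countable ∧ AmpleProp X

/-- `L'` is an induced subcomplex of `L`. -/
def IsInduced (L' L : SComplex) : Prop :=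
  L'.faces ⊆ L.faces ∧ ∀ s ∈ L.faces, (↑s : Set ℕ) ⊆ L'.vertexSet → s ∈ L'.faces

end SComplex

namespace SComplex

variable {X : SComplex}

/-- A set of pairs of vertices of `X` is a partial isomorphism if it is a one-to-one relation under
which finite sets of vertices correspond to simplexes on one side if and only if they do so on the
other. -/
structure IsPartialIso (X : SComplex) (S : Set (ℕ × ℕ)) : Prop where
  fst_mem : ∀ p ∈ S, p.1 ∈ X.vertexSet
  snd_mem : ∀ p ∈ S, p.2 ∈ X.vertexSet
  fst_eq_iff : ∀ p ∈ S, ∀ q ∈ S, p.1 = q.1 ↔ p.2 = q.2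
  mem_faces_iff : ∀ T : Finset (ℕ × ℕ), (T : Set (ℕ × ℕ)) ⊆ S →
    (T.image Prod.fst ∈ X.faces ↔ T.image Prod.snd ∈ X.faces)

theorem IsPartialIso.swap {S : Set (ℕ × ℕ)} (h : X.IsPartialIso S) :
    X.IsPartialIso (Prod.swap ⁻¹' S) where
  fst_mem p hp := h.snd_mem p.swap hp
  snd_mem p hp := h.fst_mem p.swap hp
  fst_eq_iff p hp q hq := (h.fst_eq_iff p.swap hp q.swap hq).symm
  mem_faces_iff T hT := by
    have h1 := h.mem_faces_iff (T.image Prod.swap) (by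
      rw [Finset.coe_image]
      exact Set.image_subset_iff.mpr hT)
    rw [Finset.image_image, Finset.image_image] at h1
    exact h1.symm

theorem IsPartialIso.sUnion {c : Set (Set (ℕ × ℕ))} (hn : c.Nonempty) (hc : DirectedOn (· ⊆ ·) c)
    (h : ∀ S ∈ c, X.IsPartialIso S) : X.IsPartialIso (⋃₀ c) where
  fst_mem := fun p ⟨S, hS, hp⟩ => (h S hS).fst_mem p hp
  snd_mem := fun p ⟨S, hS, hp⟩ => (h S hS).snd_mem p hp
  fst_eq_iff := fun p ⟨S, hS, hp⟩ q ⟨S', hS', hq⟩ => by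
    obtain ⟨R, hR, h1, h2⟩ := hc S hS S' hS'
    exact (h R hR).fst_eq_iff p (h1 hp) q (h2 hq)
  mem_faces_iff T hT := by
    obtain ⟨S, hS, hTS⟩ := hc.exists_mem_subset_of_finite_of_subset_sUnion hn T.finite_toSet hT
    exact (h S hS).mem_faces_iff T hTS

/-- The simplexes on the range side of a relation `S` whose preimages span a simplex together
with `v`, as a simplicial complex. -/
def transportedLink (X : SComplex) (S : Set (ℕ × ℕ)) (v : ℕ) : SComplex where
  faces := {t | ∃ T : Finset (ℕ × ℕ), (T : Set (ℕ × ℕ)) ⊆ S ∧ T.Nonempty ∧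
    insert v (T.image Prod.fst) ∈ X.faces ∧ T.image Prod.snd = t}
  nonempty_of_mem := by
    rintro _ ⟨T, -, hT, -, rfl⟩
    exact hT.image _
  down_closed := by
    rintro _ ⟨T, hTS, -, hface, rfl⟩ t ht htn
    have himage : (T.filter (·.2 ∈ t)).image Prod.snd = t := by
      ext x
      constructor
      · simp only [Finset.mem_image, Finset.mem_filter]
        rintro ⟨p, ⟨-, hp⟩, rfl⟩
        exact hp
      · intro hx
        obtain ⟨p, hp, rfl⟩ := Finset.mem_image.mp (ht hx)
        exact Finset.mem_image_of_mem _ (Finset.mem_filter.mpr ⟨hp, hx⟩)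
    refine ⟨T.filter (·.2 ∈ t), fun p hp => hTS (Finset.filter_subset _ _ hp), ?_, ?_, himage⟩
    · rw [← Finset.image_nonempty (f := Prod.snd), himage]
      exact htn
    · exact X.down_closed _ hface _
        (Finset.insert_subset_insert _ (Finset.image_subset_image (Finset.filter_subset _ _)))
        (Finset.insert_nonempty _ _)

theorem IsPartialIso.exists_insert (hX : X.AmpleProp) {S : Set (ℕ × ℕ)} (hfin : S.Finite)
    (h : X.IsPartialIso S) {v : ℕ} (hv : v ∈ X.vertexSet) :
    ∃ w, X.IsPartialIso (insert (v, w) S) := by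
  by_cases hdom : ∃ w, (v, w) ∈ S
  · obtain ⟨w, hw⟩ := hdom
    exact ⟨w, by rwa [Set.insert_eq_of_mem hw]⟩
  have snd_subset {T : Finset (ℕ × ℕ)} (hT : (T : Set (ℕ × ℕ)) ⊆ S) :
      ((T.image Prod.snd : Finset ℕ) : Set ℕ) ⊆ Prod.snd '' S := by
    rw [Finset.coe_image]
    exact Set.image_mono hT
  obtain ⟨w, ⟨hwV, hwS⟩, hlink⟩ := hX (Prod.snd '' S) (hfin.image _)
    (Set.image_subset_iff.mpr h.snd_mem) (X.transportedLink S v) (by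
      rintro _ ⟨T, hTS, hTn, hface, rfl⟩
      exact ⟨(h.mem_faces_iff T hTS).mp
        (X.down_closed _ hface _ (Finset.subset_insert _ _) (hTn.image _)), snd_subset hTS⟩)
  have hvS : ∀ p ∈ S, p.1 ≠ v := by
    rintro ⟨a, b⟩ hp rfl
    exact hdom ⟨b, hp⟩
  have hwS' : ∀ p ∈ S, p.2 ≠ w := fun p hp hpw => hwS ⟨p, hp, hpw⟩
  have key (T : Finset (ℕ × ℕ)) (hTS : (T : Set (ℕ × ℕ)) ⊆ S) :
      insert v (T.image Prod.fst) ∈ X.faces ↔ insert w (T.image Prod.snd) ∈ X.faces := by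
    obtain rfl | hTn := T.eq_empty_or_nonempty
    · exact iff_of_true hv hwV
    constructor
    · intro hface
      have hmem : T.image Prod.snd ∈ (X.transportedLink S v).faces := ⟨T, hTS, hTn, hface, rfl⟩
      rw [← hlink] at hmem
      exact hmem.1.2.2
    · intro hface
      have hT : T.image Prod.snd ∈ X.faces :=
        X.down_closed _ hface _ (Finset.subset_insert _ _) (hTn.image _)
      have hwT : w ∉ T.image Prod.snd := fun hw => hwS (snd_subset hTS hw)
      have hmem : T.image Prod.snd ∈ (X.transportedLink S v).faces := by
        rw [← hlink]
        exact ⟨⟨hT, hwT, hface⟩, hT, snd_subset hTS⟩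
      obtain ⟨T', hT'S, -, hface', heq⟩ := hmem
      have hTT' : T' = T := by
        have inj : Set.InjOn Prod.snd S := fun p hp q hq hpq =>
          Prod.ext ((h.fst_eq_iff p hp q hq).mpr hpq) hpq
        apply Finset.coe_injective
        rw [← inj.image_eq_image_iff hT'S hTS, ← Finset.coe_image, ← Finset.coe_image, heq]
      rwa [hTT'] at hface'
  refine ⟨w, ?_, ?_, ?_, ?_⟩
  · rintro p (rfl | hp)
    exacts [hv, h.fst_mem p hp]
  · rintro p (rfl | hp)
    exacts [hwV, h.snd_mem p hp]
  · rintro p (rfl | hp) q (rfl | hq)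
    · simp
    · exact iff_of_false (hvS q hq).symm (hwS' q hq).symm
    · exact iff_of_false (hvS p hp) (hwS' p hp)
    · exact h.fst_eq_iff p hp q hq
  · intro T hT
    by_cases hmem : (v, w) ∈ T
    · rw [← Finset.insert_erase hmem, Finset.image_insert, Finset.image_insert]
      refine key _ fun p hp => ?_
      obtain ⟨hne, hpT⟩ := Finset.mem_erase.mp hp
      exact (hT hpT).resolve_left hne
    · refine h.mem_faces_iff T fun p hp => (hT hp).resolve_left ?_
      rintro rfl
      exact hmem hp

theorem IsPartialIso.exists_insert_swap (hX : X.AmpleProp) {S : Set (ℕ × ℕ)} (hfin : S.Finite)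
    (h : X.IsPartialIso S) {w : ℕ} (hw : w ∈ X.vertexSet) :
    ∃ v, X.IsPartialIso (insert (v, w) S) := by
  obtain ⟨v, hv⟩ := h.swap.exists_insert hX (hfin.preimage Prod.swap_injective.injOn) hw
  refine ⟨v, ?_⟩
  convert hv.swap using 1
  ext ⟨a, b⟩
  simp [and_comm]

theorem IsPartialIso.exists_total (hX : X.AmpleProp) {S : Set (ℕ × ℕ)} (hfin : S.Finite)
    (h : X.IsPartialIso S) :
    ∃ R, S ⊆ R ∧ X.IsPartialIso R ∧ (∀ v ∈ X.vertexSet, ∃ w, (v, w) ∈ R) ∧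
      ∀ w ∈ X.vertexSet, ∃ v, (v, w) ∈ R := by
  let P := {S : Set (ℕ × ℕ) // S.Finite ∧ X.IsPartialIso S}
  let D (v : ℕ) : Order.Cofinal P :=
    { carrier := {S | v ∈ X.vertexSet → (∃ w, (v, w) ∈ S.1) ∧ ∃ u, (u, v) ∈ S.1}
      isCofinal := by
        rintro ⟨S, hS, hiso⟩
        by_cases hv : v ∈ X.vertexSet
        · obtain ⟨w, hw⟩ := hiso.exists_insert hX hS hv
          obtain ⟨u, hu⟩ := hw.exists_insert_swap hX (hS.insert _) hv
          exact ⟨⟨_, (hS.insert _).insert _, hu⟩, fun _ => ⟨⟨w, by simp⟩, ⟨u, by simp⟩⟩,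
            (Set.subset_insert _ _).trans (Set.subset_insert _ _)⟩
        · exact ⟨⟨S, hS, hiso⟩, fun hv' => absurd hv' hv, le_rfl⟩ }
  let I := Order.idealOfCofinals (⟨S, hfin, h⟩ : P) D
  have hI : (⟨S, hfin, h⟩ : P) ∈ I := Order.mem_idealOfCofinals _ _
  refine ⟨⋃₀ (Subtype.val '' (I : Set P)), Set.subset_sUnion_of_mem ⟨_, hI, rfl⟩, ?_, ?_, ?_⟩
  · refine IsPartialIso.sUnion ⟨_, _, hI, rfl⟩ ?_ ?_
    · rintro _ ⟨A, hA, rfl⟩ _ ⟨B, hB, rfl⟩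
      obtain ⟨C, hC, hAC, hBC⟩ := I.directed A hA B hB
      exact ⟨C.1, ⟨C, hC, rfl⟩, hAC, hBC⟩
    · rintro _ ⟨A, -, rfl⟩
      exact A.2.2
  · intro v hv
    obtain ⟨A, hA, hAI⟩ := Order.cofinal_meets_idealOfCofinals (⟨S, hfin, h⟩ : P) D v
    obtain ⟨w, hw⟩ := (hA hv).1
    exact ⟨w, A.1, ⟨A, hAI, rfl⟩, hw⟩
  · intro v hv
    obtain ⟨A, hA, hAI⟩ := Order.cofinal_meets_idealOfCofinals (⟨S, hfin, h⟩ : P) D v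
    obtain ⟨u, hu⟩ := (hA hv).2
    exact ⟨u, A.1, ⟨A, hAI, rfl⟩, hu⟩

theorem IsPartialIso.isIso {S : Set (ℕ × ℕ)} (h : X.IsPartialIso S) {F : ℕ → ℕ}
    (hF : ∀ v ∈ X.vertexSet, (v, F v) ∈ S) (hsurj : ∀ w ∈ X.vertexSet, ∃ v, (v, w) ∈ S) :
    X.IsIso X F := by
  refine ⟨⟨fun v hv => h.snd_mem _ (hF v hv), fun v hv w hw hvw =>
    (h.fst_eq_iff _ (hF v hv) _ (hF w hw)).mpr hvw, fun w hw => ?_⟩, fun s hs => ?_⟩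
  · obtain ⟨v, hv⟩ := hsurj w hw
    have hvV : v ∈ X.vertexSet := h.fst_mem _ hv
    exact ⟨v, hvV, (h.fst_eq_iff _ (hF v hvV) _ hv).mp rfl⟩
  · have h1 := h.mem_faces_iff (s.image fun v => (v, F v)) (by
      rw [Finset.coe_image]
      exact Set.image_subset_iff.mpr fun v hv => hF v (hs hv))
    rw [Finset.image_image, Finset.image_image] at h1
    simpa [Function.comp_def] using h1

theorem vertexSet_induced {U : Set ℕ} (hU : U ⊆ X.vertexSet) : (X.induced U).vertexSet = U := by
  ext v
  constructor
  · intro hv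
    exact hv.2 (by simp)
  · intro hv
    exact ⟨hU hv, by simpa using hv⟩

theorem IsIso.isPartialIso {U U' : Set ℕ} (hU : U ⊆ X.vertexSet) (hU' : U' ⊆ X.vertexSet)
    {f : ℕ → ℕ} (hf : (X.induced U).IsIso (X.induced U') f) :
    X.IsPartialIso ((fun u => (u, f u)) '' U) := by
  obtain ⟨hbij, hfaces⟩ := hf
  rw [vertexSet_induced hU, vertexSet_induced hU'] at hbij
  rw [vertexSet_induced hU] at hfaces
  refine ⟨?_, ?_, ?_, fun T hT => ?_⟩
  · rintro _ ⟨u, hu, rfl⟩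
    exact hU hu
  · rintro _ ⟨u, hu, rfl⟩
    exact hU' (hbij.mapsTo hu)
  · rintro _ ⟨u, hu, rfl⟩ _ ⟨v, hv, rfl⟩
    exact (hbij.injOn.eq_iff hu hv).symm
  · obtain ⟨s, hs, rfl⟩ := Finset.subset_set_image_iff.mp hT
    have hsU' : ((s.image f : Finset ℕ) : Set ℕ) ⊆ U' := by
      rw [Finset.coe_image]
      exact (hbij.mapsTo.mono_left hs).image_subset
    have h1 : s ∈ X.faces ↔ s.image f ∈ X.faces :=
      ⟨fun h => ((hfaces s hs).mp ⟨h, hs⟩).1, fun h => ((hfaces s hs).mpr ⟨h, hsU'⟩).1⟩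
    rw [Finset.image_image, Finset.image_image]
    simpa [Function.comp_def] using h1

end SComplex

/-- Every ample simplicial complex is homogeneous. -/
theorem ample_homogeneous (X : SComplex) (hX : X.IsAmple) : X.Homogeneous := by
  intro U U' hUfin _ hU hU' f hf
  obtain ⟨R, hSR, hR, htotal, hsurj⟩ :=
    (hf.isPartialIso hU hU').exists_total hX.2 (hUfin.image _)
  choose! F hF using htotal
  exact ⟨F, hR.isIso hF hsurj, fun u hu =>
    (hR.fst_eq_iff _ (hF u (hU hu)) _ (hSR ⟨u, hu, rfl⟩)).mp rfl⟩
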